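/- arXiv:cond-mat/0605150 — 4 statements merged into one kernel-verified Lean document; each statement's English description precedes it below -/
import Mathlib

section
/- For every number of particles P ≥ 1, every initial configuration X⁰, every configuration X and every t ∈ ℕ, the t-step transition probability of the totally asymmetric simple exclusion process with parallel update satisfies P_t(X) = (1−v)^{P−N_c(X)}·det F(X,X⁰,t); equivalently, since det F(X,X,0) = (1−v)^{N_c(X)−P}, one has P_t(X) = det F(X,X⁰,t) / det F(X,X,0). -/
open Finset

namespace TASEP

attribute [local instance] Classical.propDecidable

noncomputable section

/-- Generalized binomial coefficient `C(n,k) = n(n-1)⋯(n-k+1)/k!` for `n : ℤ`, `k : ℕ`. -/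
def C (n : ℤ) (k : ℕ) : ℝ :=
  (∏ i ∈ Finset.range k, ((n : ℝ) - (i : ℝ))) / (k.factorial : ℝ)

/-- `λ = v/(1-v)`. -/
def lam (v : ℝ) : ℝ := v / (1 - v)

/-- The matrix element `f(a,b,t)` of the determinant solution of the parallel TASEP. -/
def f (v : ℝ) (a b : ℤ) (t : ℕ) : ℝ :=
  if 1 ≤ a then
    (1 - v) ^ t * (-1 : ℝ) ^ a *
      ∑' k : ℕ, if 0 ≤ b + (k : ℤ) then
        C ((t : ℤ) + a) (b + (k : ℤ)).toNat * C (a + (k : ℤ) - 1) k *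
          lam v ^ (b + (k : ℤ)).toNat
      else 0
  else
    (1 - v) ^ t * (-1 : ℝ) ^ a *
      ∑' j : ℕ, if (j : ℤ) ≤ -a ∧ 0 ≤ b + (j : ℤ) then
        (-1 : ℝ) ^ j * C (-a) j * C ((t : ℤ) + a) (b + (j : ℤ)).toNat *
          lam v ^ (b + (j : ℤ)).toNat
      else 0

/-- Number of pairs of neighboring particles (occupied neighboring sites) in `x`. -/
def nPairs {P : ℕ} (x : Fin P → ℤ) : ℕ :=
  (Finset.univ.filter fun p : Fin P × Fin P =>
    ((p.2 : ℕ) = (p.1 : ℕ) + 1) ∧ x p.2 = x p.1 + 1).card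

/-- Number of clusters `N_c(x) = P - nPairs x`. -/
def Nc {P : ℕ} (x : Fin P → ℤ) : ℕ := P - nPairs x

/-- The matrix `F(X,Y,t)` with entries `f(i-j, x_i - y_j, t)`. -/
def Fmat (v : ℝ) {P : ℕ} (x y : Fin P → ℤ) (t : ℕ) : Matrix (Fin P) (Fin P) ℝ :=
  Matrix.of fun i j => f v ((i : ℤ) - (j : ℤ)) (x i - y j) t

/-- One-step transition probability of the parallel-update TASEP. -/
def Tstep (v : ℝ) {P : ℕ} (x x' : Fin P → ℤ) : ℝ :=
  ∏ i : Fin P,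
    if x i = x' i + 1 ∧ (∀ j : Fin P, (j : ℕ) = (i : ℕ) + 1 → x' i + 1 < x' j) then v
    else if x i = x' i ∧ (∀ j : Fin P, (j : ℕ) = (i : ℕ) + 1 → x' i + 1 < x' j) then 1 - v
    else if x i = x' i ∧ (∃ j : Fin P, (j : ℕ) = (i : ℕ) + 1 ∧ x' j = x' i + 1) then 1
    else 0

/-- Transformed transition probability `T₀(X,X') = (1-v)^(N_c(X)-N_c(X')) T(X,X')`. -/
def T0 (v : ℝ) {P : ℕ} (x x' : Fin P → ℤ) : ℝ :=
  (1 - v) ^ ((Nc x : ℤ) - (Nc x' : ℤ)) * Tstep v x x'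

/-- `shiftBy x k` subtracts `1` from the coordinates selected by `k`. -/
def shiftBy {P : ℕ} (x : Fin P → ℤ) (k : Fin P → Bool) : Fin P → ℤ :=
  fun i => x i - if k i then 1 else 0

/-- `t`-step probability of the parallel-update TASEP started from `x0`. -/
def Pt (v : ℝ) {P : ℕ} (x0 : Fin P → ℤ) : ℕ → (Fin P → ℤ) → ℝ
  | 0 => fun x => if x = x0 then 1 else 0
  | t + 1 => fun x => ∑ k : Fin P → Bool,
      if StrictMono (shiftBy x k) then
        Tstep v x (shiftBy x k) * Pt v x0 t (shiftBy x k)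
      else 0

/-- One-particle weight `F₀(x|t)`. -/
def F0 (v : ℝ) (x : ℤ) (t : ℕ) : ℝ :=
  if 0 ≤ x ∧ x ≤ (t : ℤ) then (t.choose x.toNat : ℝ) * v ^ x.toNat * (1 - v) ^ (t - x.toNat)
  else 0

/-- Schütz's functions `F_m(N|t)` for the backward sequential update. -/
def Fm (v : ℝ) (m : ℤ) (N : ℤ) (t : ℕ) : ℝ :=
  if 0 < m then
    ∑' k : ℕ, ((k + m.toNat - 1).choose (m.toNat - 1) : ℝ) * F0 v (N + (k : ℤ)) t
  else if m = 0 then F0 v N t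
  else
    ∑ k ∈ Finset.range (m.natAbs + 1),
      (-1 : ℝ) ^ k * (m.natAbs.choose k : ℝ) * F0 v (N + (k : ℤ)) t

/-- The functions `F̃_m(N|t)` for the parallel update. -/
def Ftil (v : ℝ) (m : ℤ) (N : ℤ) (t : ℕ) : ℝ :=
  if 0 < m then
    ∑ n ∈ Finset.range (m.toNat + 1),
      ∑' k : ℤ, if -(n : ℤ) ≤ k then
        (m.toNat.choose n : ℝ) * ((m + (n : ℤ) + k - 1).toNat.choose ((n : ℤ) + k).toNat : ℝ) *
          lam v ^ n * F0 v (N + k) t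
      else 0
  else if m = 0 then F0 v N t
  else
    ∑ n ∈ Finset.range (m.natAbs + 1),
      ∑' k : ℤ, if -(n : ℤ) ≤ k then
        (-1 : ℝ) ^ n * (m.natAbs.choose n : ℝ) *
          (((m.natAbs : ℤ) + (n : ℤ) + k - 1).toNat.choose ((n : ℤ) + k).toNat : ℝ) *
          (-(lam v)) ^ ((n : ℤ) + k).toNat * F0 v (N - k) t
      else 0

/-- One-step transition probability of the TASEP with backward sequential update. -/
def TBw (v : ℝ) {P : ℕ} (x x' : Fin P → ℤ) : ℝ :=
  ∏ i : Fin P,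
    if h : (i : ℕ) + 1 < P then
      if x' i + 1 < x' ⟨(i : ℕ) + 1, h⟩ ∨
          (x' ⟨(i : ℕ) + 1, h⟩ = x' i + 1 ∧ x ⟨(i : ℕ) + 1, h⟩ = x' ⟨(i : ℕ) + 1, h⟩ + 1) then
        (if x i = x' i + 1 then v else if x i = x' i then 1 - v else 0)
      else if x' ⟨(i : ℕ) + 1, h⟩ = x' i + 1 ∧ x ⟨(i : ℕ) + 1, h⟩ = x' ⟨(i : ℕ) + 1, h⟩ then
        (if x i = x' i then 1 else 0)
      else 0
    else
      (if x i = x' i + 1 then v else if x i = x' i then 1 - v else 0)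

/-- `t`-step probability of the backward-sequential-update TASEP started from `x0`. -/
def Pbw (v : ℝ) {P : ℕ} (x0 : Fin P → ℤ) : ℕ → (Fin P → ℤ) → ℝ
  | 0 => fun x => if x = x0 then 1 else 0
  | t + 1 => fun x => ∑ k : Fin P → Bool,
      if StrictMono (shiftBy x k) then
        TBw v x (shiftBy x k) * Pbw v x0 t (shiftBy x k)
      else 0

/-- Reversed-negated configuration `ι(X)_i = -x_{P+1-i}`. -/
def iota {P : ℕ} (x : Fin P → ℤ) : Fin P → ℤ := fun i => - x i.rev

/-- `i` is a cluster head of `x` (first particle of a cluster). -/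
def isHead {P : ℕ} (x : Fin P → ℤ) (i : Fin P) : Prop :=
  ∀ j : Fin P, (i : ℕ) = (j : ℕ) + 1 → x j + 1 < x i

/-- Position of the `i`-th walker at time `s`, given steps `ε`. -/
def walkerPos {P t : ℕ} (x0 : Fin P → ℤ) (ε : Fin P → Fin t → Bool) (i : Fin P) (s : ℕ) : ℤ :=
  x0 i + ((Finset.univ.filter fun u : Fin t => (u : ℕ) < s ∧ ε i u = true).card : ℤ)

/-- General Bethe-ansatz sum with amplitudes `A`. -/
def betheSum {P : ℕ} (z : Fin P → ℂ) (A : Equiv.Perm (Fin P) → ℂ) (x : Fin P → ℤ) : ℂ :=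
  ∑ σ : Equiv.Perm (Fin P), A σ * ∏ i : Fin P, z (σ i) ^ (-(x i))

/-- `ξ(z) = -(1+λz)/(1-1/z)`. -/
def xiC (v : ℝ) (z : ℂ) : ℂ := -(1 + (lam v : ℂ) * z) / (1 - 1 / z)

/-- Bethe amplitudes `A_σ = sgn(σ) ∏ ξ_{σ(i)}^{i-σ(i)}`. -/
def ampA (v : ℝ) {P : ℕ} (z : Fin P → ℂ) (σ : Equiv.Perm (Fin P)) : ℂ :=
  ((Equiv.Perm.sign σ : ℤ) : ℂ) * ∏ i : Fin P, xiC v (z (σ i)) ^ ((i : ℤ) - (σ i : ℤ))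

/-- The Bethe eigenfunction `B(x)`. -/
def betheB (v : ℝ) {P : ℕ} (z : Fin P → ℂ) (x : Fin P → ℤ) : ℂ :=
  betheSum z (ampA v z) x


/-! ### Generalized binomial coefficients -/

lemma C_zero (n : ℤ) : C n 0 = 1 := by simp [C]

lemma C_pascal (n : ℤ) (k : ℕ) : C (n + 1) (k + 1) = C n (k + 1) + C n k := by
  have h : ∏ i ∈ Finset.range (k + 1), (((n + 1 : ℤ) : ℝ) - (i : ℝ)) =
      ((n : ℝ) + 1) * ∏ i ∈ Finset.range k, ((n : ℝ) - (i : ℝ)) := by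
    rw [Finset.prod_range_succ', mul_comm]
    congr 1
    · push_cast; ring
    · refine Finset.prod_congr rfl fun i _ => ?_
      push_cast; ring
  unfold C
  rw [h, Finset.prod_range_succ, Nat.factorial_succ]
  have hk : (k.factorial : ℝ) ≠ 0 := by positivity
  push_cast
  field_simp
  ring

lemma C_eq_zero (n k : ℕ) (h : n < k) : C n k = 0 := by
  unfold C
  rw [Finset.prod_eq_zero (Finset.mem_range.2 h) (by simp), zero_div]

lemma C_self (n : ℕ) : C n n = 1 := by
  induction n with
  | zero => exact C_zero 0
  | succ n ih =>
    have := C_pascal n n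
    rw [C_eq_zero n (n + 1) (by omega), ih, zero_add] at this
    exact_mod_cast this

/-- Reflection of the upper index. -/
lemma C_neg (n : ℤ) (k : ℕ) : (-1 : ℝ) ^ k * C (-n) k = C (n + k - 1) k := by
  unfold C
  rw [← mul_div_assoc]
  congr 1
  rw [← Finset.prod_range_reflect (fun i : ℕ => (((n + k - 1 : ℤ) : ℝ) - (i : ℝ))),
    ← Finset.card_range k, ← Finset.prod_const, Finset.card_range, ← Finset.prod_mul_distrib]
  refine Finset.prod_congr rfl fun i hi => ?_
  have hi' : i < k := Finset.mem_range.1 hi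
  have : ((k - 1 - i : ℕ) : ℝ) = (k : ℝ) - 1 - i := by
    rw [Nat.sub_sub, Nat.cast_sub (by omega)]; push_cast; ring
  rw [this]
  push_cast
  ring

/-! ### The series defining `f` -/

/-- Coefficient of `z ^ m` in the expansion of `(1 + λ z) ^ n` at `z = 0`. -/
def binCoeff (v : ℝ) (n m : ℤ) : ℝ :=
  if 0 ≤ m then C n m.toNat * lam v ^ m.toNat else 0

/-- Coefficient of `y ^ k` in `(1 - y) ^ (-a)`. -/
def negBinCoeff (a : ℤ) (k : ℕ) : ℝ := (-1) ^ k * C (-a) k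

lemma binCoeff_of_neg (v : ℝ) (n m : ℤ) (h : m < 0) : binCoeff v n m = 0 :=
  if_neg (by omega)

lemma binCoeff_eq_zero (v : ℝ) (n m : ℤ) (hn : 0 ≤ n) (h : n < m) : binCoeff v n m = 0 := by
  lift n to ℕ using hn
  rw [binCoeff, if_pos (by omega), C_eq_zero n m.toNat (by omega), zero_mul]

lemma binCoeff_succ (v : ℝ) (n m : ℤ) :
    binCoeff v (n + 1) m = binCoeff v n m + lam v * binCoeff v n (m - 1) := by
  rcases lt_trichotomy m 0 with h | rfl | h
  · simp [binCoeff_of_neg v _ m h, binCoeff_of_neg v _ (m - 1) (by omega)]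
  · rw [binCoeff_of_neg v n (0 - 1) (by omega)]
    simp [binCoeff, C_zero]
  · obtain ⟨k, rfl⟩ : ∃ k : ℕ, m = k + 1 := ⟨(m - 1).toNat, by omega⟩
    have h1 : ((k : ℤ) + 1).toNat = k + 1 := by omega
    have h2 : ((k : ℤ) + 1 - 1).toNat = k := by omega
    rw [binCoeff, binCoeff, binCoeff, if_pos (by omega), if_pos (by omega), if_pos (by omega),
      h1, h2, C_pascal]
    ring

lemma negBinCoeff_eq_zero (a : ℤ) (k : ℕ) (ha : a ≤ 0) (h : -a < k) : negBinCoeff a k = 0 := by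
  obtain ⟨n, rfl⟩ : ∃ n : ℕ, a = -n := ⟨(-a).toNat, by omega⟩
  rw [negBinCoeff, neg_neg, C_eq_zero n k (by omega), mul_zero]

lemma negBinCoeff_zero (a : ℤ) : negBinCoeff a 0 = 1 := by simp [negBinCoeff, C_zero]

lemma negBinCoeff_succ (a : ℤ) (k : ℕ) :
    negBinCoeff a (k + 1) = negBinCoeff (a + 1) (k + 1) - negBinCoeff (a + 1) k := by
  have := C_pascal (-(a + 1)) k
  rw [show -(a + 1) + 1 = -a by ring] at this
  simp only [negBinCoeff, this]
  ring

/-- `f` as a series with summand valid for both signs of `a`. -/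
lemma f_eq_tsum (v : ℝ) (a b : ℤ) (t : ℕ) :
    f v a b t = (1 - v) ^ t * (-1 : ℝ) ^ a *
      ∑' k : ℕ, negBinCoeff a k * binCoeff v (t + a) (b + k) := by
  unfold f
  split_ifs with ha
  · congr 1
    refine tsum_congr fun k => ?_
    rw [negBinCoeff, C_neg, binCoeff]
    split_ifs <;> ring
  · congr 1
    refine tsum_congr fun k => ?_
    by_cases hk : (k : ℤ) ≤ -a
    · rw [negBinCoeff, binCoeff]
      simp only [hk, true_and]
      split_ifs <;> ring
    · rw [if_neg (fun h => hk h.1), negBinCoeff_eq_zero a k (by omega) (by omega), zero_mul]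

lemma summable_coeff (v : ℝ) (a n b : ℤ) (h : 0 ≤ n ∨ a ≤ 0) :
    Summable fun k : ℕ => negBinCoeff a k * binCoeff v n (b + k) := by
  refine summable_of_ne_finset_zero
    (s := Finset.range ((n - b).toNat + (-a).toNat + 1)) fun k hk => ?_
  rw [Finset.mem_range, not_lt] at hk
  rcases h with h | h
  · rw [binCoeff_eq_zero v n _ h (by omega), mul_zero]
  · rw [negBinCoeff_eq_zero a k h (by omega), zero_mul]

/-- Time evolution of `f`. -/
lemma f_succ (v : ℝ) (hv1 : v < 1) (a b : ℤ) (t : ℕ) :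
    f v a b (t + 1) = (1 - v) * f v a b t + v * f v a (b - 1) t := by
  have hv : 1 - v ≠ 0 := by linarith
  have h : 0 ≤ (t : ℤ) + a ∨ a ≤ 0 := by omega
  have key : ∑' k : ℕ, negBinCoeff a k * binCoeff v (((t + 1 : ℕ) : ℤ) + a) (b + k) =
      ∑' k : ℕ, negBinCoeff a k * binCoeff v (t + a) (b + k) +
      lam v * ∑' k : ℕ, negBinCoeff a k * binCoeff v (t + a) (b - 1 + k) := by
    rw [← tsum_mul_left, ← (summable_coeff v a _ b h).tsum_add
      ((summable_coeff v a _ (b - 1) h).mul_left _)]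
    refine tsum_congr fun k => ?_
    rw [show ((t + 1 : ℕ) : ℤ) + a = t + a + 1 by push_cast; ring, binCoeff_succ,
      show b + (k : ℤ) - 1 = b - 1 + k by ring]
    ring
  rw [f_eq_tsum, f_eq_tsum, f_eq_tsum, key]
  unfold lam
  field_simp
  ring

/-- Relation between `f` at neighboring values of the first argument. -/
lemma f_sub (v : ℝ) (a b : ℤ) (t : ℕ) :
    f v (a + 1) b t - f v (a + 1) (b + 1) t = -(f v a b t + lam v * f v a (b - 1) t) := by
  have h : 0 ≤ (t : ℤ) + a ∨ a ≤ 0 := by omega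
  have h1 : 0 ≤ (t : ℤ) + (a + 1) ∨ a ≤ 0 := by omega
  have h2 : 0 ≤ (t : ℤ) + (a + 1) ∨ a + 1 ≤ 0 := by omega
  have key : ∑' k : ℕ, negBinCoeff a k * binCoeff v (t + (a + 1)) (b + k) =
      ∑' k : ℕ, negBinCoeff a k * binCoeff v (t + a) (b + k) +
      lam v * ∑' k : ℕ, negBinCoeff a k * binCoeff v (t + a) (b - 1 + k) := by
    rw [← tsum_mul_left, ← (summable_coeff v a _ b h).tsum_add
      ((summable_coeff v a _ (b - 1) h).mul_left _)]
    refine tsum_congr fun k => ?_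
    rw [← add_assoc, binCoeff_succ, show b + (k : ℤ) - 1 = b - 1 + k by ring]
    ring
  have key' : ∑' k : ℕ, negBinCoeff a k * binCoeff v (t + (a + 1)) (b + k) =
      ∑' k : ℕ, negBinCoeff (a + 1) k * binCoeff v (t + (a + 1)) (b + k) -
      ∑' k : ℕ, negBinCoeff (a + 1) k * binCoeff v (t + (a + 1)) (b + 1 + k) := by
    rw [(summable_coeff v a _ b h1).tsum_eq_zero_add,
      (summable_coeff v (a + 1) _ b h2).tsum_eq_zero_add, add_sub_assoc,
      ← ((summable_nat_add_iff 1).2 (summable_coeff v (a + 1) _ b h2)).tsum_sub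
        (summable_coeff v (a + 1) _ (b + 1) h2)]
    simp only [negBinCoeff_zero]
    congr 1
    refine tsum_congr fun k => ?_
    rw [negBinCoeff_succ, show b + ((k + 1 : ℕ) : ℤ) = b + 1 + k by push_cast; ring]
    ring
  rw [f_eq_tsum, f_eq_tsum, f_eq_tsum, f_eq_tsum]
  rw [key'] at key
  rw [zpow_add₀ (by norm_num), zpow_one]
  linear_combination (-(1 - v) ^ t * (-1 : ℝ) ^ a) * key

lemma f_zero_of_lt (v : ℝ) (a b : ℤ) (ha : 0 ≤ a) (h : a < b) : f v a b 0 = 0 := by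
  rw [f_eq_tsum, tsum_congr (g := fun _ => 0), tsum_zero, mul_zero]
  intro k
  rw [binCoeff_eq_zero v _ _ (by simpa using ha) (by push_cast; omega), mul_zero]

lemma f_zero_of_gt (v : ℝ) (a b : ℤ) (ha : a ≤ 0) (h : b < a) : f v a b 0 = 0 := by
  rw [f_eq_tsum, tsum_congr (g := fun _ => 0), tsum_zero, mul_zero]
  intro k
  by_cases hk : b + (k : ℤ) < 0
  · rw [binCoeff_of_neg v _ _ hk, mul_zero]
  · rw [negBinCoeff_eq_zero a k ha (by omega), zero_mul]

lemma f_zero_diag_nat (v : ℝ) (n : ℕ) : f v n n 0 = (-lam v) ^ n := by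
  rw [f_eq_tsum, tsum_eq_single 0]
  · simp [negBinCoeff_zero, binCoeff, C_self, ← mul_pow]
  · intro k hk
    rw [binCoeff_eq_zero v _ _ (by simp) (by push_cast; omega), mul_zero]

lemma f_zero_diag_neg (v : ℝ) (n : ℕ) : f v (-n) (-n) 0 = 1 := by
  rw [f_eq_tsum, tsum_eq_single n]
  · simp [negBinCoeff, binCoeff, C_zero, C_self]
  · intro k hk
    by_cases h : k < n
    · rw [binCoeff_of_neg v _ _ (by omega), mul_zero]
    · rw [negBinCoeff_eq_zero _ k (by omega) (by omega), zero_mul]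

/-! ### Counting neighboring pairs -/

lemma not_isHead_iff {P : ℕ} {x : Fin P → ℤ} (hx : StrictMono x) (i : Fin P) :
    ¬ isHead x i ↔ ∃ j : Fin P, (i : ℕ) = (j : ℕ) + 1 ∧ x i = x j + 1 := by
  unfold isHead
  push Not
  refine exists_congr fun j => and_congr_right fun h => ?_
  have := hx (show j < i by rw [Fin.lt_def]; omega)
  omega

lemma pow_nPairs_eq_prod_head {P : ℕ} {x : Fin P → ℤ} (hx : StrictMono x) (r : ℝ) :
    r ^ nPairs x = ∏ i : Fin P, if isHead x i then 1 else r := by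
  rw [Finset.prod_ite, Finset.prod_const_one, one_mul, Finset.prod_const]
  congr 1
  refine Finset.card_bij (fun p _ => p.2) ?_ ?_ ?_
  · intro p hp
    simp only [Finset.mem_filter, Finset.mem_univ, true_and] at hp ⊢
    exact (not_isHead_iff hx _).2 ⟨p.1, hp⟩
  · rintro ⟨a, b⟩ hp ⟨c, d⟩ hq h
    simp only [Finset.mem_filter, Finset.mem_univ, true_and] at hp hq h
    subst h
    rw [Prod.mk.injEq]
    exact ⟨Fin.ext (by omega), rfl⟩
  · intro i hi
    simp only [Finset.mem_filter, Finset.mem_univ, true_and] at hi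
    obtain ⟨j, hj⟩ := (not_isHead_iff hx _).1 hi
    exact ⟨(j, i), by simpa using hj, rfl⟩

lemma pow_nPairs_eq_prod_next {P : ℕ} (x : Fin P → ℤ) (r : ℝ) :
    r ^ nPairs x =
      ∏ i : Fin P, if ∃ j : Fin P, (j : ℕ) = (i : ℕ) + 1 ∧ x j = x i + 1 then r else 1 := by
  rw [Finset.prod_ite, Finset.prod_const_one, mul_one, Finset.prod_const]
  congr 1
  refine Finset.card_bij (fun p _ => p.1) ?_ ?_ ?_
  · intro p hp
    simp only [Finset.mem_filter, Finset.mem_univ, true_and] at hp ⊢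
    exact ⟨p.2, hp⟩
  · rintro ⟨a, b⟩ hp ⟨c, d⟩ hq h
    simp only [Finset.mem_filter, Finset.mem_univ, true_and] at hp hq h
    subst h
    rw [Prod.mk.injEq]
    exact ⟨rfl, Fin.ext (by omega)⟩
  · intro i hi
    simp only [Finset.mem_filter, Finset.mem_univ, true_and] at hi
    obtain ⟨j, hj⟩ := hi
    exact ⟨(i, j), by simpa using hj, rfl⟩

lemma nPairs_le {P : ℕ} (x : Fin P → ℤ) : nPairs x ≤ P := by
  conv_rhs => rw [← Fintype.card_fin P, ← Finset.card_univ]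
  refine Finset.card_le_card_of_injOn Prod.fst (fun _ _ => Finset.mem_coe.2 (Finset.mem_univ _)) ?_
  rintro ⟨a, b⟩ hp ⟨c, d⟩ hq h
  simp only [Finset.coe_filter, Finset.mem_univ, true_and, Set.mem_ofPred_eq] at hp hq h
  subst h
  rw [Prod.mk.injEq]
  exact ⟨rfl, Fin.ext (by omega)⟩

lemma sub_Nc {P : ℕ} (x : Fin P → ℤ) : (P : ℤ) - (Nc x : ℤ) = (nPairs x : ℤ) := by
  have := nPairs_le x
  unfold Nc
  omega

/-! ### One time step -/

/-- Weight of the choice `b` for particle `i` in the expansion of the determinant. -/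
def headWeight (v : ℝ) {P : ℕ} (x : Fin P → ℤ) (i : Fin P) (b : Bool) : ℝ :=
  if isHead x i then (if b then v else 1 - v) else (if b then 0 else 1)

lemma isHead_succ {n : ℕ} {x : Fin (n + 1) → ℤ} (i : Fin n) :
    isHead x i.succ ↔ x i.castSucc + 1 < x i.succ := by
  constructor
  · intro h
    exact h i.castSucc (by simp)
  · intro h j hj
    have : j = i.castSucc := Fin.ext (by simpa using hj.symm)
    rwa [this]

lemma isHead_zero {n : ℕ} (x : Fin (n + 1) → ℤ) : isHead x 0 := by
  intro j hj
  simp at hj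

/-- Subtracting multiples of the preceding row freezes every particle that is not a head. -/
lemma det_Fmat_succ (v : ℝ) (hv1 : v < 1) {n : ℕ} (y : Fin (n + 1) → ℤ) {x : Fin (n + 1) → ℤ}
    (hx : StrictMono x) (t : ℕ) :
    (Fmat v x y (t + 1)).det = (Matrix.of fun i j : Fin (n + 1) => if isHead x i then
      (1 - v) * f v ((i : ℤ) - (j : ℤ)) (x i - y j) t +
        v * f v ((i : ℤ) - (j : ℤ)) (x i - y j - 1) t
      else f v ((i : ℤ) - (j : ℤ)) (x i - y j) t).det := by
  have hv : 1 - v ≠ 0 := by linarith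
  refine Matrix.det_eq_of_forall_row_eq_smul_add_pred
    (fun i => if isHead x i.succ then 0 else -lam v) (fun j => ?_) (fun i j => ?_)
  · simp only [Fmat, Matrix.of_apply, isHead_zero, if_true]
    exact f_succ v hv1 _ _ _
  · simp only [Fmat, Matrix.of_apply]
    split_ifs with h
    · rw [zero_mul, add_zero]
      exact f_succ v hv1 _ _ _
    · have hlt := hx (Fin.castSucc_lt_succ (i := i))
      have hxi : x i.succ = x i.castSucc + 1 := by
        rw [isHead_succ] at h; omega
      rw [f_succ v hv1, f_succ v hv1, hxi]
      have e := f_sub v ((i.castSucc : ℕ) - (j : ℤ)) (x i.castSucc - y j) t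
      rw [show ((i.succ : ℕ) : ℤ) - (j : ℤ) = (i.castSucc : ℕ) - (j : ℤ) + 1 by
          simp only [Fin.val_succ, Fin.val_castSucc]; push_cast; ring,
        show x i.castSucc + 1 - y j - 1 = x i.castSucc - y j by ring,
        show x i.castSucc + 1 - y j = x i.castSucc - y j + 1 by ring]
      have hl : lam v * (1 - v) = v := by unfold lam; field_simp
      linear_combination v * e +
        (f v ((i.castSucc : ℕ) - (j : ℤ)) (x i.castSucc - y j) t) * hl

lemma det_Fmat_succ_eq_sum (v : ℝ) (hv1 : v < 1) {n : ℕ} (y : Fin (n + 1) → ℤ)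
    {x : Fin (n + 1) → ℤ} (hx : StrictMono x) (t : ℕ) :
    (Fmat v x y (t + 1)).det = ∑ k : Fin (n + 1) → Bool,
      (∏ i, headWeight v x i (k i)) * (Fmat v (shiftBy x k) y t).det := by
  rw [det_Fmat_succ v hv1 y hx t]
  set g : Fin (n + 1) → Bool → Fin (n + 1) → ℝ := fun i b j =>
    f v ((i : ℤ) - (j : ℤ)) (x i - (if b then 1 else 0) - y j) t with hg
  have hrow : (Matrix.of fun i j : Fin (n + 1) => if isHead x i then
      (1 - v) * f v ((i : ℤ) - (j : ℤ)) (x i - y j) t +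
        v * f v ((i : ℤ) - (j : ℤ)) (x i - y j - 1) t
      else f v ((i : ℤ) - (j : ℤ)) (x i - y j) t) =
      (fun i => ∑ b : Bool, headWeight v x i b • g i b : Fin (n + 1) → Fin (n + 1) → ℝ) := by
    funext i j
    simp only [Matrix.of_apply, hg, headWeight, Fintype.sum_bool, Pi.add_apply, Pi.smul_apply,
      smul_eq_mul, if_true, Bool.false_eq_true, if_false, sub_zero]
    rw [show x i - 1 - y j = x i - y j - 1 by ring]
    split_ifs <;> ring
  rw [hrow]
  change Matrix.detRowAlternating.toMultilinearMap _ = _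
  rw [MultilinearMap.map_sum]
  refine Finset.sum_congr rfl fun k _ => ?_
  rw [MultilinearMap.map_smul_univ, smul_eq_mul]
  rfl

lemma shiftBy_strictMono {P : ℕ} {x : Fin P → ℤ} (hx : StrictMono x) {k : Fin P → Bool}
    (hk : ∀ i, k i = true → isHead x i) : StrictMono (shiftBy x k) := by
  intro a b hab
  have h1 := hx hab
  unfold shiftBy
  by_cases hb : k b = true
  · have hj : (b : ℕ) - 1 < P := by omega
    have hab' : (a : ℕ) < b := hab
    have h2 := hk b hb ⟨(b : ℕ) - 1, hj⟩ (by simp; omega)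
    have h3 := hx.monotone (show a ≤ ⟨(b : ℕ) - 1, hj⟩ by rw [Fin.le_def]; simp; omega)
    split_ifs <;> omega
  · split_ifs <;> omega

/-- The weights in the determinant expansion are the transition probabilities, up to the
factors counting neighboring pairs. -/
lemma prod_headWeight (v : ℝ) {P : ℕ} {x : Fin P → ℤ} (hx : StrictMono x) (k : Fin P → Bool) :
    (1 - v) ^ nPairs x * ∏ i, headWeight v x i (k i) =
      if StrictMono (shiftBy x k) then
        Tstep v x (shiftBy x k) * (1 - v) ^ nPairs (shiftBy x k) else 0 := by
  by_cases hk : ∀ i, k i = true → isHead x i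
  · have hx' := shiftBy_strictMono hx hk
    rw [if_pos hx', pow_nPairs_eq_prod_head hx, pow_nPairs_eq_prod_next, Tstep,
      ← Finset.prod_mul_distrib, ← Finset.prod_mul_distrib]
    refine Finset.prod_congr rfl fun i _ => ?_
    have hnext : (∀ j : Fin P, (j : ℕ) = (i : ℕ) + 1 → shiftBy x k i + 1 < shiftBy x k j) ↔
        ¬ ∃ j : Fin P, (j : ℕ) = (i : ℕ) + 1 ∧ shiftBy x k j = shiftBy x k i + 1 := by
      push Not
      refine forall_congr' fun j => forall_congr' fun hj => ?_
      have := hx' (show i < j by rw [Fin.lt_def]; omega)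
      omega
    simp only [hnext]
    by_cases hki : k i = true
    · have hne : ¬ ∃ j : Fin P, (j : ℕ) = (i : ℕ) + 1 ∧ shiftBy x k j = shiftBy x k i + 1 := by
        rintro ⟨j, hj, e⟩
        have h1 := hx (show i < j by rw [Fin.lt_def]; omega)
        simp only [shiftBy, hki, if_true] at e
        by_cases hkj : k j = true
        · have := hk j hkj i hj
          simp only [hkj, if_true] at e
          omega
        · simp only [hkj] at e
          simp at e
          omega
      have hs : x i = shiftBy x k i + 1 := by simp [shiftBy, hki]
      rw [if_pos (hk i hki), if_neg hne, if_pos ⟨hs, hne⟩]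
      simp [headWeight, hk i hki, hki]
    · have hs : shiftBy x k i = x i := by simp [shiftBy, hki]
      simp only [Bool.not_eq_true] at hki
      by_cases hne : ∃ j : Fin P, (j : ℕ) = (i : ℕ) + 1 ∧ shiftBy x k j = shiftBy x k i + 1
      · rw [if_neg (c := _ ∧ _) (fun h => by omega), if_neg (c := _ ∧ _) (mt And.right (not_not.2 hne)),
          if_pos (c := _ ∧ _) ⟨hs.symm, hne⟩, if_pos hne]
        by_cases hh : isHead x i <;> simp [headWeight, hki, hh]
      · rw [if_neg (c := _ ∧ _) (fun h => by omega), if_pos (c := _ ∧ _) ⟨hs.symm, hne⟩, if_neg hne]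
        by_cases hh : isHead x i <;> simp [headWeight, hki, hh]
  · push Not at hk
    obtain ⟨i, hki, hi⟩ := hk
    have h0 : ∏ i, headWeight v x i (k i) = 0 :=
      Finset.prod_eq_zero (Finset.mem_univ i) (by simp [headWeight, hki, hi])
    rw [h0, mul_zero]
    split_ifs with hx'
    · obtain ⟨j, hj, e⟩ := (not_isHead_iff hx i).1 hi
      have hlt := hx' (show j < i by rw [Fin.lt_def]; omega)
      have hkj : k j = true := by
        by_contra hkj
        simp only [shiftBy, hki, hkj, if_true] at hlt
        simp at hlt
        omega
      have hsj : shiftBy x k j = x j - 1 := by simp [shiftBy, hkj]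
      have hsi : shiftBy x k i = x j := by simp [shiftBy, hki, e]
      rw [Tstep, Finset.prod_eq_zero (Finset.mem_univ j), zero_mul]
      rw [if_neg, if_neg, if_neg]
      · rintro ⟨h, -⟩; omega
      · rintro ⟨h, -⟩; omega
      · rintro ⟨-, h⟩
        have := h i hj
        omega
    · rfl

/-! ### The initial condition -/

lemma det_eq_zero_of_block {P : ℕ} (M : Matrix (Fin P) (Fin P) ℝ) (s r : Finset (Fin P))
    (hc : r.card < s.card) (h : ∀ j ∈ s, ∀ i ∉ r, M i j = 0) : M.det = 0 := by
  rw [Matrix.det_apply]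
  refine Finset.sum_eq_zero fun σ _ => ?_
  obtain ⟨j, hj, hσ⟩ : ∃ j ∈ s, σ j ∉ r := by
    by_contra! hcon
    exact absurd (Finset.card_le_card_of_injOn σ hcon σ.injective.injOn) (by omega)
  rw [Finset.prod_eq_zero (f := fun i => M (σ i) i) (Finset.mem_univ j) (h j hj _ hσ), smul_zero]

lemma gap_le {P : ℕ} {x : Fin P → ℤ} (hx : StrictMono x) {i j : Fin P} (h : i ≤ j) :
    x i - (i : ℤ) ≤ x j - (j : ℤ) := by
  obtain ⟨i, hi⟩ := i
  obtain ⟨j, hj⟩ := j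
  rw [Fin.mk_le_mk] at h
  induction j, h using Nat.le_induction with
  | base => exact le_rfl
  | succ j hij ih =>
    have h1 := ih (by omega)
    have h2 := hx (show (⟨j, by omega⟩ : Fin P) < ⟨j + 1, hj⟩ by simp)
    simp only at h1 ⊢
    push_cast
    omega

lemma Fmat_zero_lower (v : ℝ) {P : ℕ} (x y : Fin P → ℤ) {i j : Fin P} (h : j ≤ i)
    (hu : y j - (j : ℤ) < x i - (i : ℤ)) : Fmat v x y 0 i j = 0 := by
  rw [Fin.le_def] at h
  exact f_zero_of_lt v _ _ (by omega) (by omega)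

lemma Fmat_zero_upper (v : ℝ) {P : ℕ} (x y : Fin P → ℤ) {i j : Fin P} (h : i ≤ j)
    (hu : x i - (i : ℤ) < y j - (j : ℤ)) : Fmat v x y 0 i j = 0 := by
  rw [Fin.le_def] at h
  exact f_zero_of_gt v _ _ (by omega) (by omega)

lemma det_Fmat_zero_of_ne (v : ℝ) {P : ℕ} {x y : Fin P → ℤ} (hx : StrictMono x)
    (hy : StrictMono y) (hne : x ≠ y) : (Fmat v x y 0).det = 0 := by
  obtain ⟨m, hm⟩ := Function.ne_iff.1 hne
  rcases lt_or_gt_of_ne hm with h | h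
  · refine det_eq_zero_of_block _ (Finset.Ici m) (Finset.Ioi m)
      (by rw [Fin.card_Ioi, Fin.card_Ici]; omega) fun j hj i hi => ?_
    rw [Finset.mem_Ici] at hj
    rw [Finset.mem_Ioi, not_lt] at hi
    have h1 := gap_le hx hi
    have h2 := gap_le hy hj
    exact Fmat_zero_upper v x y (hi.trans hj) (by omega)
  · refine det_eq_zero_of_block _ (Finset.Iic m) (Finset.Iio m)
      (by rw [Fin.card_Iio, Fin.card_Iic]; omega) fun j hj i hi => ?_
    rw [Finset.mem_Iic] at hj
    rw [Finset.mem_Iio, not_lt] at hi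
    have h1 := gap_le hx hi
    have h2 := gap_le hy hj
    exact Fmat_zero_lower v x y (hj.trans hi) (by omega)

lemma Fmat_self_lower (v : ℝ) {P : ℕ} (x : Fin P → ℤ) {i j : Fin P} (h : j ≤ i)
    (hu : x i - (i : ℤ) = x j - (j : ℤ)) :
    Fmat v x x 0 i j = (-lam v) ^ ((i : ℕ) - (j : ℕ)) := by
  rw [Fin.le_def] at h
  rw [← f_zero_diag_nat, Fmat, Matrix.of_apply]
  congr 1 <;> omega

lemma Fmat_self_upper (v : ℝ) {P : ℕ} (x : Fin P → ℤ) {i j : Fin P} (h : i ≤ j)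
    (hu : x i - (i : ℤ) = x j - (j : ℤ)) : Fmat v x x 0 i j = 1 := by
  rw [Fin.le_def] at h
  rw [← f_zero_diag_neg v ((j : ℕ) - (i : ℕ)), Fmat, Matrix.of_apply]
  congr 1 <;> omega

lemma det_Fmat_self (v : ℝ) {n : ℕ} {x : Fin (n + 1) → ℤ} (hx : StrictMono x) :
    (Fmat v x x 0).det = (1 + lam v) ^ nPairs x := by
  set c : Fin n → ℝ := fun i => if isHead x i.succ then 0 else -lam v with hc
  set B : Matrix (Fin (n + 1)) (Fin (n + 1)) ℝ := fun i j =>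
    Fin.cases (Fmat v x x 0 0 j)
      (fun i' => Fmat v x x 0 i'.succ j - c i' * Fmat v x x 0 i'.castSucc j) i with hB
  have hdet : (Fmat v x x 0).det = B.det :=
    Matrix.det_eq_of_forall_row_eq_smul_add_pred c (fun j => by simp [hB])
      (fun i j => by simp [hB])
  rw [hdet, Matrix.det_of_isUpperTriangular, pow_nPairs_eq_prod_head hx]
  · refine Finset.prod_congr rfl fun i _ => ?_
    refine Fin.cases ?_ (fun i => ?_) i
    · simp only [hB, Fin.cases_zero, isHead_zero, if_true]
      exact Fmat_self_upper v x le_rfl rfl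
    · simp only [hB, hc, Fin.cases_succ]
      rw [Fmat_self_upper v x le_rfl rfl]
      split_ifs with h
      · ring
      · have hlt := hx (Fin.castSucc_lt_succ (i := i))
        rw [isHead_succ] at h
        rw [Fmat_self_upper v x Fin.castSucc_lt_succ.le (by simp; omega)]
        ring
  · intro i j hij
    change j < i at hij
    revert hij
    refine Fin.cases (fun h => absurd h (Fin.not_lt_zero j)) (fun i hij => ?_) i
    have hji : j ≤ i.castSucc := Fin.le_castSucc_iff.2 hij
    have hlt := hx (Fin.castSucc_lt_succ (i := i))
    have hg := gap_le hx hji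
    simp only [hB, hc, Fin.cases_succ]
    split_ifs with h
    · rw [isHead_succ] at h
      rw [Fmat_zero_lower v x x hij.le (by simp at hg ⊢; omega)]
      ring
    · rw [isHead_succ] at h
      have hs : x i.succ - (i.succ : ℕ) = x i.castSucc - (i.castSucc : ℕ) := by
        simp; omega
      rcases hg.lt_or_eq with hg | hg
      · rw [Fmat_zero_lower v x x hij.le (by omega), Fmat_zero_lower v x x hji hg]
        ring
      · rw [Fmat_self_lower v x hij.le (by omega), Fmat_self_lower v x hji hg.symm]
        rw [Fin.le_def] at hji
        simp only [Fin.val_succ, Fin.val_castSucc] at hji ⊢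
        rw [Nat.succ_sub hji, pow_succ]
        ring

lemma one_add_lam (v : ℝ) (hv1 : v < 1) : 1 + lam v = (1 - v)⁻¹ := by
  have hv : 1 - v ≠ 0 := by linarith
  unfold lam
  field_simp
  ring

lemma Pt_eq (v : ℝ) (hv1 : v < 1) {n : ℕ} {x0 : Fin (n + 1) → ℤ} (hx0 : StrictMono x0) (t : ℕ) :
    ∀ x : Fin (n + 1) → ℤ, StrictMono x →
      Pt v x0 t x = (1 - v) ^ nPairs x * (Fmat v x x0 t).det := by
  have hv : 1 - v ≠ 0 := by linarith
  induction t with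
  | zero =>
    intro x hx
    by_cases h : x = x0
    · subst h
      simp only [Pt, if_true]
      rw [det_Fmat_self v hx, one_add_lam v hv1, ← mul_pow, mul_inv_cancel₀ hv,
        one_pow]
    · simp only [Pt, h, if_false]
      rw [det_Fmat_zero_of_ne v hx hx0 h, mul_zero]
  | succ t ih =>
    intro x hx
    rw [Pt, det_Fmat_succ_eq_sum v hv1 x0 hx, Finset.mul_sum]
    refine Finset.sum_congr rfl fun k _ => ?_
    rw [← mul_assoc, prod_headWeight v hx]
    split_ifs with h
    · rw [ih _ h, mul_assoc]
    · rw [zero_mul]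

/-- Determinant solution of the parallel-update TASEP:
`P_t(X) = (1-v)^(P-N_c(X)) det F(X,X⁰,t) = det F(X,X⁰,t) / det F(X,X,0)`. -/
theorem parallel_tasep_determinant_solution
    (v : ℝ) (hv0 : 0 < v) (hv1 : v < 1) (P : ℕ) (hP : 1 ≤ P)
    (x0 x : Fin P → ℤ) (hx0 : StrictMono x0) (hx : StrictMono x) (t : ℕ) :
    Pt v x0 t x = (1 - v) ^ ((P : ℤ) - (Nc x : ℤ)) * (Fmat v x x0 t).det ∧
    (Fmat v x x 0).det = (1 - v) ^ ((Nc x : ℤ) - (P : ℤ)) ∧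
    Pt v x0 t x = (Fmat v x x0 t).det / (Fmat v x x 0).det := by
  obtain ⟨n, rfl⟩ : ∃ n, P = n + 1 := ⟨P - 1, by omega⟩
  have hv : 1 - v ≠ 0 := by linarith
  have hself : (Fmat v x x 0).det = (1 - v) ^ ((Nc x : ℤ) - ((n + 1 : ℕ) : ℤ)) := by
    rw [det_Fmat_self v hx, one_add_lam v hv1, ← neg_sub (((n + 1 : ℕ) : ℤ)), sub_Nc, zpow_neg, zpow_natCast, inv_pow]
  have hmain : Pt v x0 t x =
      (1 - v) ^ (((n + 1 : ℕ) : ℤ) - (Nc x : ℤ)) * (Fmat v x x0 t).det := by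
    rw [Pt_eq v hv1 hx0 t x hx, sub_Nc, zpow_natCast]
  refine ⟨hmain, hself, ?_⟩
  rw [hmain, hself, ← neg_sub (((n + 1 : ℕ) : ℤ)), zpow_neg, div_inv_eq_mul, mul_comm]

end

end TASEP
end

section
/- (Proposition 1.) Let P ≥ 1, let X = (x_1<⋯<x_P) and Y = (y_1<⋯<y_P) be configurations of P particles, and let σ be a permutation of {1,…,P}. If f(i − σ(i), x_i − y_{σ(i)}, 0) ≠ 0 for every i ∈ {1,…,P}, then x_i = y_i for every i and x_i − x_{σ(i)} = i − σ(i) for every i; in particular σ only permutes particles within the clusters of X. -/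
open Finset

namespace TASEP

attribute [local instance] Classical.propDecidable

noncomputable section

theorem C_eq_zero_of_lt {n : ℤ} {k : ℕ} (hn : 0 ≤ n) (hk : n < k) : C n k = 0 := by
  lift n to ℕ using hn
  rw [C, Finset.prod_eq_zero (Finset.mem_range.2 (Nat.cast_lt.1 hk)) (by simp), zero_div]

theorem le_of_f_zero_ne_zero {v : ℝ} {a b : ℤ} (ha : 0 ≤ a) (h : f v a b 0 ≠ 0) : b ≤ a := by
  contrapose! h
  have hC (k : ℕ) : C a (b + (k : ℤ)).toNat = 0 :=
    C_eq_zero_of_lt ha (by lia)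
  simp [f, hC]

theorem ge_of_f_zero_ne_zero {v : ℝ} {a b : ℤ} (ha : a ≤ 0) (h : f v a b 0 ≠ 0) : a ≤ b := by
  contrapose! h
  have hj (j : ℕ) : ¬((j : ℤ) ≤ -a ∧ 0 ≤ b + (j : ℤ)) := by lia
  simp [f, hj, show ¬ 1 ≤ a by lia]

/-- A permutation which sends a point out of a finite set sends another one into it. -/
theorem exists_mem_apply_notMem {α : Type*} [Finite α] (σ : Equiv.Perm α) {s : Set α} {i : α}
    (hi : i ∉ s) (hσ : σ i ∈ s) : ∃ j ∈ s, σ j ∉ s := by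
  by_contra! h
  exact hi (by simpa using Equiv.Perm.perm_symm_mapsTo_of_mapsTo σ h hσ)

/-- If `u` and `w` are monotone and `σ` moves indices up only where `w ∘ σ ≤ u` and down only where
`u ≤ w ∘ σ`, then `u = w` and `w` is constant along the cycles of `σ`. -/
theorem eq_and_apply_perm_eq {α β : Type*} [Finite α] [LinearOrder α] [PartialOrder β]
    {u w : α → β} (hu : Monotone u) (hw : Monotone w) (σ : Equiv.Perm α)
    (hdown : ∀ i, σ i ≤ i → u i ≤ w (σ i)) (hup : ∀ i, i ≤ σ i → w (σ i) ≤ u i) (i : α) :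
    u i = w i ∧ w (σ i) = w i := by
  rcases lt_trichotomy i (σ i) with hi | hi | hi
  · obtain ⟨j, hij, hj⟩ := exists_mem_apply_notMem σ (s := Set.Ioi i) (lt_irrefl i) hi
    simp only [Set.mem_Ioi, not_lt] at hij hj
    have hui : u i ≤ w i := (hu hij.le).trans ((hdown j (hj.trans hij.le)).trans (hw hj))
    exact ⟨hui.antisymm ((hw hi.le).trans (hup i hi.le)),
      ((hup i hi.le).trans hui).antisymm (hw hi.le)⟩
  · have h := (hdown i hi.ge).antisymm (hup i hi.le)
    rw [← hi] at h ⊢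
    exact ⟨h, rfl⟩
  · obtain ⟨j, hij, hj⟩ := exists_mem_apply_notMem σ (s := Set.Iio i) (lt_irrefl i) hi
    simp only [Set.mem_Iio, not_lt] at hij hj
    have hui : w i ≤ u i := (hw hj).trans ((hup j (hij.le.trans hj)).trans (hu hij.le))
    exact ⟨((hdown i hi.le).trans (hw hi.le)).antisymm hui,
      (hw hi.le).antisymm (hui.trans (hdown i hi.le))⟩

theorem monotone_sub_index {P : ℕ} {x : Fin P → ℤ} (hx : StrictMono x) :
    Monotone fun i => x i - (i : ℤ) := by
  cases P with
  | zero => exact fun i => i.elim0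
  | succ n =>
    refine Fin.monotone_iff_le_succ.2 fun i => ?_
    have := hx i.castSucc_lt_succ
    simp only [Fin.val_castSucc, Fin.val_succ]
    lia

/-- Proposition 1: if `f(i-σ(i), x_i - y_{σ(i)}, 0) ≠ 0` for all `i`, then `X = Y` and
`σ` permutes particles only within clusters of `X`. -/
theorem proposition_one
    (v : ℝ) (hv0 : 0 < v) (hv1 : v < 1) (P : ℕ) (hP : 1 ≤ P)
    (x y : Fin P → ℤ) (hx : StrictMono x) (hy : StrictMono y)
    (σ : Equiv.Perm (Fin P))
    (hne : ∀ i : Fin P, f v ((i : ℤ) - (σ i : ℤ)) (x i - y (σ i)) 0 ≠ 0) :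
    (∀ i, x i = y i) ∧ ∀ i : Fin P, x i - x (σ i) = (i : ℤ) - (σ i : ℤ) := by
  have key := eq_and_apply_perm_eq (monotone_sub_index hx) (monotone_sub_index hy) σ
    (fun i hi => by
      have := le_of_f_zero_ne_zero (sub_nonneg.2 (by exact_mod_cast hi)) (hne i)
      lia)
    (fun i hi => by
      have := ge_of_f_zero_ne_zero (sub_nonpos.2 (by exact_mod_cast hi)) (hne i)
      lia)
  refine ⟨fun i => by have := (key i).1; lia, fun i => ?_⟩
  have h₁ := key i
  have h₂ := key (σ i)
  lia

end

end TASEP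
end

section
/- Let R be a commutative ring, λ ∈ R and n ≥ 1. The n×n matrix S(n) with entries S(n)_{ij} = (−λ)^{j−i} for j ≥ i and S(n)_{ij} = 1 for j < i has determinant det S(n) = (1+λ)^{n−1}. -/
open Finset

namespace TASEP

attribute [local instance] Classical.propDecidable

noncomputable section

/-- Adding `a` times each column to the next one makes the cluster block lower triangular. -/
theorem det_cluster_block_succ {R : Type*} [CommRing R] (a : R) (n : ℕ) :
    (Matrix.of fun i j : Fin (n + 1) =>
        if (i : ℕ) ≤ (j : ℕ) then (-a) ^ ((j : ℕ) - (i : ℕ)) else 1).det = (1 + a) ^ n := by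
  rw [Matrix.det_eq_of_forall_col_eq_smul_add_pred
    (B := Matrix.of fun i j : Fin (n + 1) =>
      if (j : ℕ) ≤ (i : ℕ) then (if (j : ℕ) = 0 then 1 else 1 + a) else 0) (fun _ => -a)]
  · rw [Matrix.det_of_isLowerTriangular, Fin.prod_univ_succ]
    · simp
    · intro i j hij
      have h : (i : ℕ) < (j : ℕ) := hij
      exact if_neg h.not_ge
  · intro i
    by_cases h : (i : ℕ) = 0 <;> simp [h]
  · intro i j
    simp only [Matrix.of_apply, Fin.val_succ, Fin.val_castSucc]
    rcases lt_trichotomy (i : ℕ) ((j : ℕ) + 1) with h | h | h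
    · have hj : (i : ℕ) ≤ j := Nat.le_of_lt_succ h
      rw [if_pos h.le, if_neg h.not_ge, if_pos hj, Nat.succ_sub hj, pow_succ]
      ring
    · simp [h]
    · rw [if_neg h.not_ge, if_pos h.le, if_neg (Nat.succ_ne_zero _), if_neg (by omega)]
      ring

/-- Determinant of the single-cluster block `S(n)`:
`S(n)_{ij} = (-λ)^(j-i)` for `j ≥ i`, `1` for `j < i`, and `det S(n) = (1+λ)^(n-1)`. -/
theorem det_cluster_block
    (R : Type*) [CommRing R] (lamr : R) (n : ℕ) (hn : 1 ≤ n) :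
    (Matrix.of fun i j : Fin n =>
        if (i : ℕ) ≤ (j : ℕ) then (-lamr) ^ ((j : ℕ) - (i : ℕ)) else 1).det
      = (1 + lamr) ^ (n - 1) := by
  obtain ⟨m, rfl⟩ := Nat.exists_eq_add_of_le' hn
  exact det_cluster_block_succ lamr m

end

end TASEP
end

section
/- Let X, X′ be configurations of P particles with T(X,X′) ≠ 0. Call i ∈ {1,…,P} a cluster head of X if i = 1 or x_i > x_{i−1} + 1, so that X has exactly N_c(X) cluster heads. Then T₀(X,X′) = v^{J}·(1−v)^{N_c(X)−J}, where J is the number of cluster heads i of X with x_i = x′_i + 1. -/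
open Finset

namespace TASEP

attribute [local instance] Classical.propDecidable

noncomputable section

/-- `i` is the last particle of its cluster in `x`, so that it is free to move. -/
def isTail {P : ℕ} (x : Fin P → ℤ) (i : Fin P) : Prop :=
  ∀ j : Fin P, (j : ℕ) = (i : ℕ) + 1 → x i + 1 < x j

theorem add_one_le_of_succ {P : ℕ} {x : Fin P → ℤ} (hx : StrictMono x) {i j : Fin P}
    (h : (j : ℕ) = (i : ℕ) + 1) : x i + 1 ≤ x j :=
  hx (show i < j by rw [Fin.lt_def]; omega)

theorem card_not_isHead {P : ℕ} {x : Fin P → ℤ} (hx : StrictMono x) :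
    (Finset.univ.filter fun i : Fin P => ¬ isHead x i).card = nPairs x := by
  symm
  refine Finset.card_bij (fun p _ => p.2) ?_ ?_ ?_
  · rintro ⟨a, b⟩ hp
    simp only [Finset.mem_filter, Finset.mem_univ, true_and] at hp ⊢
    intro h
    have := h a hp.1
    omega
  · rintro ⟨a, b⟩ hp ⟨c, d⟩ hq h
    simp only [Finset.mem_filter, Finset.mem_univ, true_and] at hp hq h
    subst h
    exact Prod.ext (Fin.ext (by simp only; omega)) rfl
  · intro b hb
    simp only [Finset.mem_filter, Finset.mem_univ, true_and, isHead, not_forall, not_lt] at hb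
    obtain ⟨a, hab, hle⟩ := hb
    refine ⟨(a, b), ?_, rfl⟩
    simp only [Finset.mem_filter, Finset.mem_univ, true_and]
    exact ⟨hab, le_antisymm hle (add_one_le_of_succ hx hab)⟩

theorem card_not_isTail {P : ℕ} {x : Fin P → ℤ} (hx : StrictMono x) :
    (Finset.univ.filter fun i : Fin P => ¬ isTail x i).card = nPairs x := by
  symm
  refine Finset.card_bij (fun p _ => p.1) ?_ ?_ ?_
  · rintro ⟨a, b⟩ hp
    simp only [Finset.mem_filter, Finset.mem_univ, true_and] at hp ⊢
    intro h
    have := h b hp.1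
    omega
  · rintro ⟨a, b⟩ hp ⟨c, d⟩ hq h
    simp only [Finset.mem_filter, Finset.mem_univ, true_and] at hp hq h
    subst h
    exact Prod.ext rfl (Fin.ext (by simp only; omega))
  · intro a ha
    simp only [Finset.mem_filter, Finset.mem_univ, true_and, isTail, not_forall, not_lt] at ha
    obtain ⟨b, hab, hle⟩ := ha
    refine ⟨(a, b), ?_, rfl⟩
    simp only [Finset.mem_filter, Finset.mem_univ, true_and]
    exact ⟨hab, le_antisymm hle (add_one_le_of_succ hx hab)⟩

theorem card_isHead {P : ℕ} {x : Fin P → ℤ} (hx : StrictMono x) :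
    (Finset.univ.filter fun i : Fin P => isHead x i).card = Nc x := by
  have h := Finset.card_filter_add_card_filter_not (s := Finset.univ)
    (fun i : Fin P => isHead x i)
  rw [card_not_isHead hx, Finset.card_univ, Fintype.card_fin] at h
  unfold Nc
  omega

theorem card_isTail {P : ℕ} {x : Fin P → ℤ} (hx : StrictMono x) :
    (Finset.univ.filter fun i : Fin P => isTail x i).card = Nc x := by
  have h := Finset.card_filter_add_card_filter_not (s := Finset.univ)
    (fun i : Fin P => isTail x i)
  rw [card_not_isTail hx, Finset.card_univ, Fintype.card_fin] at h
  unfold Nc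
  omega

/-- In an allowed transition every particle either jumps from the end of its cluster or stays. -/
theorem jump_or_stay_of_Tstep_ne_zero {v : ℝ} {P : ℕ} {x x' : Fin P → ℤ}
    (hT : Tstep v x x' ≠ 0) (i : Fin P) :
    (x i = x' i + 1 ∧ isTail x' i) ∨ x i = x' i := by
  have h := Finset.prod_ne_zero_iff.mp hT i (Finset.mem_univ i)
  by_contra hc
  rw [not_or] at hc
  exact h (by rw [if_neg fun h => hc.1 ⟨h.1, h.2⟩, if_neg fun h => hc.2 h.1, if_neg fun h => hc.2 h.1])

theorem isHead_of_jump {v : ℝ} {P : ℕ} {x x' : Fin P → ℤ} (hx' : StrictMono x')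
    (hT : Tstep v x x' ≠ 0) {i : Fin P} (hi : x i = x' i + 1) : isHead x i := by
  intro j hj
  have hle := add_one_le_of_succ hx' hj
  rcases jump_or_stay_of_Tstep_ne_zero hT j with ⟨h, ht⟩ | h
  · have := ht i hj
    omega
  · omega

theorem Tstep_eq_of_ne_zero {v : ℝ} {P : ℕ} {x x' : Fin P → ℤ} (hx' : StrictMono x')
    (hT : Tstep v x x' ≠ 0) :
    Tstep v x x' = v ^ (Finset.univ.filter fun i : Fin P => x i = x' i + 1).card *
      (1 - v) ^ (Finset.univ.filter fun i : Fin P => isTail x' i ∧ ¬ x i = x' i + 1).card := by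
  have h : ∀ i : Fin P,
      (if x i = x' i + 1 ∧ (∀ j : Fin P, (j : ℕ) = (i : ℕ) + 1 → x' i + 1 < x' j) then v
      else if x i = x' i ∧ (∀ j : Fin P, (j : ℕ) = (i : ℕ) + 1 → x' i + 1 < x' j) then 1 - v
      else if x i = x' i ∧ (∃ j : Fin P, (j : ℕ) = (i : ℕ) + 1 ∧ x' j = x' i + 1) then 1
      else 0) =
      (if x i = x' i + 1 then v else 1) *
        (if isTail x' i ∧ ¬ x i = x' i + 1 then 1 - v else 1) := by
    intro i
    rcases jump_or_stay_of_Tstep_ne_zero hT i with ⟨h, ht⟩ | h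
    · rw [if_pos ⟨h, ht⟩, if_pos h, if_neg fun hc => hc.2 h, mul_one]
    · have hne : ¬ x i = x' i + 1 := by omega
      rw [if_neg fun hc => hne hc.1, if_neg hne, one_mul]
      by_cases ht : isTail x' i
      · rw [if_pos ⟨h, ht⟩, if_pos ⟨ht, hne⟩]
      · have hn : ∃ j : Fin P, (j : ℕ) = (i : ℕ) + 1 ∧ x' j = x' i + 1 := by
          simp only [isTail, not_forall, not_lt] at ht
          obtain ⟨j, hj, hle⟩ := ht
          exact ⟨j, hj, le_antisymm hle (add_one_le_of_succ hx' hj)⟩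
        rw [if_neg fun hc => ht hc.2, if_pos ⟨h, hn⟩, if_neg fun hc => ht hc.1]
  unfold Tstep
  rw [Finset.prod_congr rfl fun i _ => h i, Finset.prod_mul_distrib, ← Finset.prod_filter,
    ← Finset.prod_filter, Finset.prod_const, Finset.prod_const]

/-- Cluster form of `T₀`: if `T(X,X') ≠ 0` then `X` has exactly `N_c(X)` cluster heads and
`T₀(X,X') = v^J (1-v)^(N_c(X)-J)` where `J` counts cluster heads of `X` that received
a particle from behind. -/
theorem T0_cluster_form
    (v : ℝ) (hv0 : 0 < v) (hv1 : v < 1) (P : ℕ) (hP : 1 ≤ P)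
    (x x' : Fin P → ℤ) (hx : StrictMono x) (hx' : StrictMono x')
    (hT : Tstep v x x' ≠ 0) :
    (Finset.univ.filter fun i : Fin P => isHead x i).card = Nc x ∧
    T0 v x x'
      = v ^ ((Finset.univ.filter fun i : Fin P => isHead x i ∧ x i = x' i + 1).card) *
        (1 - v) ^ ((Nc x : ℤ) -
          ((Finset.univ.filter fun i : Fin P => isHead x i ∧ x i = x' i + 1).card : ℤ)) := by
  have hJ : (Finset.univ.filter fun i : Fin P => isHead x i ∧ x i = x' i + 1) =
      Finset.univ.filter fun i : Fin P => x i = x' i + 1 :=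
    Finset.filter_congr fun i _ => ⟨fun h => h.2, fun h => ⟨isHead_of_jump hx' hT h, h⟩⟩
  have hI : (Finset.univ.filter fun i : Fin P => isTail x' i ∧ x i = x' i + 1) =
      Finset.univ.filter fun i : Fin P => x i = x' i + 1 :=
    Finset.filter_congr fun i _ => ⟨fun h => h.2, fun h =>
      ⟨(jump_or_stay_of_Tstep_ne_zero hT i).elim (fun h' => h'.2) fun h' => by omega, h⟩⟩
  have hcard := Finset.card_filter_add_card_filter_not
    (s := Finset.univ.filter fun i : Fin P => isTail x' i) (fun i : Fin P => x i = x' i + 1)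
  rw [Finset.filter_filter, Finset.filter_filter, hI, card_isTail hx'] at hcard
  refine ⟨card_isHead hx, ?_⟩
  have hv : (1 - v) ≠ 0 := by linarith
  rw [hJ, T0, Tstep_eq_of_ne_zero hx' hT, mul_left_comm, ← zpow_natCast (1 - v),
    ← zpow_add₀ hv]
  congr 2
  omega

end

end TASEP
end
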